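/- Let n ∈ ℕ, let d > 0 and r > 0 be rational numbers, and for 1 ≤ j ≤ n set φⱼ = j·√2·d/r and let rⱼ > 0 be positive real amplitudes. Suppose a₁,…,aₙ, b₁,…,bₙ ∈ {0,1}. Then ∑ⱼ (aⱼ − bⱼ)·rⱼ·e^{iφⱼ} = 0 if and only if aⱼ = bⱼ for all j, provided the numbers rⱼ are algebraic. -/

import Mathlib

open Polynomial in
/-- If `x ^ 2` is an integer, then the sum of the values at `x` and `-x` of an integer polynomial
is an integer. -/
theorem Polynomial.exists_int_eq_aeval_add_aeval_neg {R : Type*} [CommRing R] (g : ℤ[X])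
    {x : R} {M : ℤ} (hx : x ^ 2 = M) : ∃ m : ℤ, aeval x g + aeval (-x) g = (m : R) := by
  induction g using Polynomial.induction_on' with
  | add p q hp hq =>
    obtain ⟨m, hm⟩ := hp
    obtain ⟨k, hk⟩ := hq
    refine ⟨m + k, ?_⟩
    rw [map_add, map_add, Int.cast_add, ← hm, ← hk]
    ring
  | monomial n a =>
    rcases Nat.even_or_odd' n with ⟨k, rfl | rfl⟩
    · refine ⟨2 * a * M ^ k, ?_⟩
      simp only [aeval_monomial, pow_mul, neg_sq, hx]
      push_cast
      simp
      ring
    · refine ⟨0, ?_⟩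
      have h : Odd (2 * k + 1) := ⟨k, rfl⟩
      simp [aeval_monomial, h.neg_pow]

/-- `c ^ p / (p - 1)!` becomes arbitrarily small along the primes. -/
theorem Nat.exists_prime_mul_pow_div_factorial_lt_one (N : ℕ) (A c : ℝ) :
    ∃ p > N, p.Prime ∧ A * (c ^ p / ((p - 1).factorial : ℝ)) < 1 := by
  have h := (FloorSemiring.tendsto_pow_div_factorial_atTop c).const_mul (A * c)
  rw [mul_zero] at h
  obtain ⟨m, hm⟩ := Filter.eventually_atTop.1 (h.eventually_lt_const one_pos)
  obtain ⟨p, hp, hprime⟩ := Nat.exists_infinite_primes (N + m + 1)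
  refine ⟨p, by omega, hprime, ?_⟩
  obtain ⟨q, rfl⟩ : ∃ q, p = q + 1 := ⟨p - 1, by omega⟩
  refine lt_of_eq_of_lt ?_ (hm q (by omega))
  rw [Nat.add_sub_cancel]
  ring

open Polynomial in
/-- If `α ^ 2` is a nonzero integer, then `exp α` is transcendental. -/
theorem Complex.transcendental_exp_of_sq_eq_intCast {α : ℂ} {M : ℤ} (hM : M ≠ 0)
    (hα : α ^ 2 = M) : Transcendental ℤ (Complex.exp α) := by
  rintro ⟨P, hP, hPα⟩
  set s := P.support with hs
  -- the differences of exponents, scaled by `α`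
  set r : ℕ × ℕ → ℂ := fun x ↦ ((x.1 : ℂ) - x.2) * α with hr
  set w : ℕ × ℕ → ℤ := fun x ↦ P.coeff x.1 * P.coeff x.2 with hw
  have hr_sq (x : ℕ × ℕ) : r x ^ 2 = ((M * ((x.1 : ℤ) - x.2) ^ 2 : ℤ) : ℂ) := by
    simp only [hr, mul_pow, hα]
    push_cast
    ring
  set f : ℤ[X] := ∏ x ∈ s.offDiag, (X ^ 2 - C (M * ((x.1 : ℤ) - x.2) ^ 2)) with hf
  have hf0 : f.eval 0 ≠ 0 := by
    rw [hf, eval_prod, Finset.prod_ne_zero_iff]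
    intro x hx
    have hne : (x.1 : ℤ) - x.2 ≠ 0 := by
      have := (Finset.mem_offDiag.1 hx).2.2
      omega
    simp [hM, hne]
  have hf_ne : f ≠ 0 := by
    rintro h
    simp [h] at hf0
  have hroot {x : ℕ × ℕ} (hx : x ∈ s.offDiag) {y : ℂ} (hy : y ^ 2 = r x ^ 2) :
      y ∈ f.aroots ℂ := by
    rw [mem_aroots]
    refine ⟨hf_ne, ?_⟩
    rw [hf, map_prod]
    refine Finset.prod_eq_zero hx ?_
    rw [map_sub, map_pow, aeval_X, aeval_C, hy, hr_sq]
    simp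
  set c₀ : ℤ := ∑ i ∈ s, P.coeff i ^ 2 with hc₀
  have hc₀_pos : 0 < c₀ := by
    refine Finset.sum_pos (fun i hi ↦ ?_) (by simpa [hs] using hP)
    have := mem_support_iff.1 hi
    positivity
  have hexp : (2 * c₀ : ℂ) + ∑ x ∈ s.offDiag, (w x : ℂ) * (exp (r x) + exp (-r x)) = 0 := by
    have hprod : ∑ x ∈ s ×ˢ s, (w x : ℂ) * (exp (r x) + exp (-r x)) = 0 := by
      have h₀ : ∑ i ∈ s, (P.coeff i : ℂ) * exp α ^ i = 0 := by
        simpa [aeval_def, eval₂_eq_sum, Polynomial.sum] using hPα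
      have h₁ : ∑ x ∈ s ×ˢ s, (w x : ℂ) * exp (r x) = 0 := by
        rw [Finset.sum_product]
        have (i j : ℕ) : (w (i, j) : ℂ) * exp (r (i, j)) =
            (P.coeff i * exp α ^ i) * (P.coeff j * exp (-(j * α))) := by
          have hr' : r (i, j) = i * α + -(j * α) := by simp only [hr]; ring
          rw [hr', Complex.exp_add, ← Complex.exp_nat_mul]
          push_cast [hw]
          ring
        simp_rw [this, ← Finset.mul_sum, ← Finset.sum_mul, h₀, zero_mul]
      have h₂ : ∑ x ∈ s ×ˢ s, (w x : ℂ) * exp (-r x) = 0 := by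
        rw [Finset.sum_product]
        have (i j : ℕ) : (w (i, j) : ℂ) * exp (-r (i, j)) =
            (P.coeff i * exp (-(i * α))) * (P.coeff j * exp α ^ j) := by
          have hr' : -r (i, j) = -(i * α) + j * α := by simp only [hr]; ring
          rw [hr', Complex.exp_add, ← Complex.exp_nat_mul]
          push_cast [hw]
          ring
        simp_rw [this, ← Finset.mul_sum, h₀, mul_zero, Finset.sum_const_zero]
      simp_rw [mul_add, Finset.sum_add_distrib, h₁, h₂, add_zero]
    rw [← Finset.diag_union_offDiag, Finset.sum_union (Finset.disjoint_diag_offDiag s),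
      Finset.sum_diag] at hprod
    rw [← hprod, hc₀]
    push_cast
    rw [Finset.mul_sum]
    congr 1
    refine Finset.sum_congr rfl fun i _ ↦ ?_
    simp [hw, hr]
    ring
  obtain ⟨c, hc⟩ := LindemannWeierstrass.exp_polynomial_approx f hf0
  obtain ⟨p, hp_gt, hp, hp_lt⟩ := Nat.exists_prime_mul_pow_div_factorial_lt_one
    ((f.eval 0).natAbs + (2 * c₀).natAbs) (∑ x ∈ s.offDiag, ‖(w x : ℂ)‖ * 2) c
  obtain ⟨n, hn, g, -, hg⟩ := hc p (by omega) hp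
  choose m hm using fun x ↦ g.exists_int_eq_aeval_add_aeval_neg (hr_sq x)
  -- the integer approximating zero
  set N : ℤ := n * (2 * c₀) + p * ∑ x ∈ s.offDiag, w x * m x with hN
  have hN_ne : N ≠ 0 := by
    intro h0
    have hdvd : (p : ℤ) ∣ n * (2 * c₀) := by
      rw [← dvd_add_left (dvd_mul_right (p : ℤ) (∑ x ∈ s.offDiag, w x * m x)), ← hN, h0]
      exact dvd_zero _
    rcases (Nat.prime_iff_prime_int.1 hp).dvd_or_dvd hdvd with h | h
    · exact hn h
    · have := Int.le_of_dvd (by omega) h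
      omega
  have hN_eq : (N : ℂ) = -∑ x ∈ s.offDiag, (w x : ℂ) *
      ((n • exp (r x) - p • aeval (r x) g) + (n • exp (-r x) - p • aeval (-r x) g)) := by
    have (x : ℕ × ℕ) : (w x : ℂ) *
        ((n • exp (r x) - p • aeval (r x) g) + (n • exp (-r x) - p • aeval (-r x) g)) =
        n * (w x * (exp (r x) + exp (-r x))) - p * (w x * m x) := by
      rw [← hm, zsmul_eq_mul, zsmul_eq_mul, nsmul_eq_mul, nsmul_eq_mul]
      ring
    simp_rw [this, Finset.sum_sub_distrib, ← Finset.mul_sum]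
    rw [eq_neg_of_add_eq_zero_right hexp, hN]
    push_cast
    ring
  have hN_lt : ‖(N : ℂ)‖ < 1 := by
    refine lt_of_le_of_lt ?_ hp_lt
    rw [hN_eq, norm_neg, Finset.sum_mul]
    refine norm_sum_le_of_le _ fun x hx ↦ ?_
    rw [norm_mul, mul_assoc]
    gcongr
    refine (norm_add_le _ _).trans ?_
    have h₁ := hg (hroot hx rfl)
    have h₂ := hg (hroot hx (neg_sq (r x)))
    linarith
  rw [Complex.norm_intCast] at hN_lt
  exact hN_ne (Int.abs_lt_one_iff.1 (by exact_mod_cast hN_lt))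

/-- If `α ^ 2` is a nonzero rational number, then `exp α` is transcendental. -/
theorem Complex.transcendental_exp_of_sq_eq_ratCast {α : ℂ} {q : ℚ} (hq : q ≠ 0)
    (hα : α ^ 2 = q) : Transcendental ℚ (Complex.exp α) := by
  intro h
  have hden : (q.den : ℂ) ≠ 0 := by exact_mod_cast q.den_ne_zero
  refine Complex.transcendental_exp_of_sq_eq_intCast (α := q.den * α) (M := q.num * q.den)
    (mul_ne_zero (Rat.num_ne_zero.2 hq) (by exact_mod_cast q.den_ne_zero)) ?_ ?_
  · rw [mul_pow, hα, Rat.cast_def]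
    push_cast
    field_simp
  · rw [Complex.exp_nat_mul]
    exact (IsFractionRing.isAlgebraic_iff ℤ ℚ ℂ).2 (h.pow q.den)

open Polynomial in
/-- A nontrivial polynomial relation with algebraic coefficients cannot hold at a transcendental
number. -/
theorem Transcendental.eq_zero_of_sum_mul_pow_succ {K L : Type*} [Field K] [Field L] [Algebra K L]
    {z : L} (hz : Transcendental K z) {n : ℕ} {c : Fin n → L} (hc : ∀ j, IsAlgebraic K (c j))
    (h : ∑ j, c j * z ^ ((j : ℕ) + 1) = 0) (j : Fin n) : c j = 0 := by
  have hz' : Transcendental (algebraicClosure K L) z := hz.extendScalars _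
  set c' : Fin n → algebraicClosure K L := fun j ↦ ⟨c j, mem_algebraicClosure_iff.2 (hc j)⟩
  have hQ : ∑ j, C (c' j) * X ^ ((j : ℕ) + 1) = 0 := by
    by_contra hne
    refine hz' ⟨_, hne, ?_⟩
    simpa [map_sum, c'] using h
  have := congrArg (fun Q ↦ Q.coeff ((j : ℕ) + 1)) hQ
  simp only [finsetSum_coeff, coeff_C_mul, coeff_X_pow, coeff_zero, add_left_inj, Fin.val_inj,
    mul_ite, mul_one, mul_zero, Finset.sum_ite_eq, Finset.mem_univ, if_true] at this
  exact congrArg Subtype.val this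

theorem stmt_5 (n : ℕ) (d r : ℚ) (hd : 0 < d) (hr : 0 < r)
    (rr : Fin n → ℝ) (hrr : ∀ j, 0 < rr j) (hralg : ∀ j, IsAlgebraic ℚ (rr j))
    (a b : Fin n → ℝ)
    (ha : ∀ j, a j = 0 ∨ a j = 1) (hb : ∀ j, b j = 0 ∨ b j = 1) :
    (∑ j, ((a j : ℂ) - (b j : ℂ)) * (rr j : ℂ)
        * Complex.exp ((((j : ℕ) + 1 : ℝ) * Real.sqrt 2 * (d : ℝ) / (r : ℝ) : ℂ) * Complex.I) = 0)
      ↔ ∀ j, a j = b j := by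
  refine ⟨fun h j ↦ ?_, fun h ↦ Finset.sum_eq_zero fun j _ ↦ by simp [h j]⟩
  set α : ℂ := (Real.sqrt 2 : ℂ) * d / r * Complex.I with hα
  have hα_sq : α ^ 2 = ((-2 * (d / r) ^ 2 : ℚ) : ℂ) := by
    have h2 : (Real.sqrt 2 : ℂ) ^ 2 = 2 := by
      rw [← Complex.ofReal_pow, Real.sq_sqrt zero_le_two, Complex.ofReal_ofNat]
    rw [hα, mul_pow, div_pow, mul_pow, h2, Complex.I_sq]
    push_cast
    ring
  have hz : Transcendental ℚ (Complex.exp α) :=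
    Complex.transcendental_exp_of_sq_eq_ratCast
      (mul_ne_zero (by norm_num) (pow_ne_zero _ (div_pos hd hr).ne')) hα_sq
  have hbit {x : ℝ} (hx : x = 0 ∨ x = 1) : IsAlgebraic ℚ (x : ℂ) := by
    rcases hx with rfl | rfl
    · simpa using isAlgebraic_zero
    · simpa using isAlgebraic_one
  have hc (j : Fin n) : IsAlgebraic ℚ (((a j : ℂ) - b j) * rr j) :=
    ((hbit (ha j)).sub (hbit (hb j))).mul ((hralg j).algebraMap (A := ℂ))
  have h0 := hz.eq_zero_of_sum_mul_pow_succ hc (by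
    rw [← h]
    refine Finset.sum_congr rfl fun j _ ↦ ?_
    rw [← Complex.exp_nat_mul, hα]
    congr 2
    push_cast
    ring) j
  have hne : (rr j : ℂ) ≠ 0 := Complex.ofReal_ne_zero.2 (hrr j).ne'
  exact Complex.ofReal_injective (sub_eq_zero.1 ((mul_eq_zero.1 h0).resolve_right hne))
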